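/- arXiv:2210.08341 — 3 statements merged into one kernel-verified Lean document; each statement's English description precedes it below -/
import Mathlib

section
/- Let d ∈ {1,2,3}, let Ω ⊆ ℝ^d be a nonempty bounded open set, let b, c > 0 and k, σ ∈ ℝ. If ψ is admissible and solves the Blackstock equation ψ_tt − c²(1 − 2k ψ_t)Δψ − b Δψ_t + 2σ ∇ψ·∇ψ_t = 0 on an open time interval I × Ω, then for every t ∈ I the function F₁(t) := ∫_Ω (ψ(t) ψ_t(t) + (b/2)|∇ψ(t)|²) is differentiable and F₁′(t) + c² ∫_Ω |∇ψ(t)|² = ∫_Ω ψ_t(t)² + ∫_Ω f(t) ψ(t), where f := −2k c² ψ_t Δψ − 2σ ∇ψ·∇ψ_t. -/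
open MeasureTheory Real

noncomputable section

/-- Euclidean space ℝ^d. -/
abbrev Spc (d : ℕ) := EuclideanSpace ℝ (Fin d)

variable {d : ℕ}

/-- Spatial Laplacian: sum of second derivatives in the coordinate directions. -/
def lap (g : Spc d → ℝ) (x : Spc d) : ℝ :=
  ∑ i, fderiv ℝ (fun y => fderiv ℝ g y (EuclideanSpace.single i 1)) x (EuclideanSpace.single i 1)

/-- Squared L²(Ω) norm: ‖g‖² = ∫_Ω g². -/
def sqL2 (Ω : Set (Spc d)) (g : Spc d → ℝ) : ℝ := ∫ x in Ω, (g x) ^ 2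

/-- Squared L²(Ω) norm of the gradient: ‖∇g‖² = ∫_Ω |∇g|². -/
def sqGrad (Ω : Set (Spc d)) (g : Spc d → ℝ) : ℝ := ∫ x in Ω, ‖gradient g x‖ ^ 2

/-- Squared L²(Ω) norm of the Hessian: ‖D²g‖² = ∫_Ω |D²g|². -/
def sqHess (Ω : Set (Spc d)) (g : Spc d → ℝ) : ℝ := ∫ x in Ω, ‖iteratedFDeriv ℝ 2 g x‖ ^ 2

/-- Squared H¹(Ω) norm. -/
def sqH1 (Ω : Set (Spc d)) (g : Spc d → ℝ) : ℝ := sqL2 Ω g + sqGrad Ω g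

/-- Squared H²(Ω) norm. -/
def sqH2 (Ω : Set (Spc d)) (g : Spc d → ℝ) : ℝ := sqL2 Ω g + sqGrad Ω g + sqHess Ω g

/-- H⁻¹(Ω) norm by duality against smooth compactly supported test functions. -/
def negH1 (Ω : Set (Spc d)) (g : Spc d → ℝ) : ℝ :=
  sSup { r : ℝ | ∃ φ : Spc d → ℝ, ContDiff ℝ (⊤ : ℕ∞) φ ∧ HasCompactSupport φ ∧ tsupport φ ⊆ Ω ∧
      (∫ x in Ω, ‖gradient φ x‖ ^ 2) ≤ 1 ∧ r = ∫ x in Ω, g x * φ x }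

/-- Admissible: smooth in (t,x), with spatial support in a fixed compact subset of Ω. -/
def Admissible (Ω : Set (Spc d)) (w : ℝ → Spc d → ℝ) : Prop :=
  ContDiff ℝ (⊤ : ℕ∞) (fun p : ℝ × Spc d => w p.1 p.2) ∧
  ∃ K : Set (Spc d), IsCompact K ∧ K ⊆ Ω ∧ ∀ t, Function.support (w t) ⊆ K

/-- Inner product of two spatial gradients: ∇g·∇h. -/
def gdot (g h : Spc d → ℝ) (x : Spc d) : ℝ := @inner ℝ _ _ (gradient g x) (gradient h x)

/-- Time derivative. -/
def tderiv (w : ℝ → Spc d → ℝ) (t : ℝ) (x : Spc d) : ℝ := deriv (fun s => w s x) t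

/-- The Blackstock equation ψ_tt − c²(1 − 2k ψ_t)Δψ − b Δψ_t + 2σ ∇ψ·∇ψ_t = 0
holds at time `t` on `Ω`. -/
def IsBlackstock (Ω : Set (Spc d)) (b c k σ : ℝ) (ψ : ℝ → Spc d → ℝ) (t : ℝ) : Prop :=
  ∀ x ∈ Ω,
    (tderiv (tderiv ψ) t x - c ^ 2 * (1 - 2 * k * tderiv ψ t x) * lap (ψ t) x
      - b * lap (tderiv ψ t) x
      + 2 * σ * gdot (ψ t) (tderiv ψ t) x) = 0

/-- Energy E(t). -/
def energy (Ω : Set (Spc d)) (b c : ℝ) (ψ : ℝ → Spc d → ℝ) (t : ℝ) : ℝ :=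
  (1 / 2) * sqL2 Ω (tderiv ψ t) + (c ^ 2 / 2) * sqGrad Ω (ψ t)
    + (c ^ 2 / (2 * b)) * sqL2 Ω (lap (ψ t)) + sqGrad Ω (tderiv ψ t)

/-- Dissipation D(t). -/
def dissip (Ω : Set (Spc d)) (ψ : ℝ → Spc d → ℝ) (t : ℝ) : ℝ :=
  ∫ s in (0:ℝ)..t,
    (sqGrad Ω (tderiv ψ s) + sqL2 Ω (lap (tderiv ψ s)) + sqGrad Ω (ψ s)
      + sqL2 Ω (lap (ψ s)) + sqL2 Ω (tderiv (tderiv ψ) s))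

/-- Supremum of a function of time over [0,T]. -/
def supIcc (T : ℝ) (f : ℝ → ℝ) : ℝ := ⨆ t : Set.Icc (0:ℝ) T, f t

/-- f := −2k c² ψ_t Δψ − 2σ ∇ψ·∇ψ_t, the right-hand side nonlinearity. -/
def blackF (c k σ : ℝ) (ψ : ℝ → Spc d → ℝ) (t : ℝ) (x : Spc d) : ℝ :=
  -(2 * k * c ^ 2) * tderiv ψ t x * lap (ψ t) x - 2 * σ * gdot (ψ t) (tderiv ψ t) x

/-- The nonlocal heat equation v_t − b Δv − c² Δψ = f (with v = ψ_t) holds at time `t` on `Ω`. -/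
def IsHeat (Ω : Set (Spc d)) (b c : ℝ) (ψ f : ℝ → Spc d → ℝ) (t : ℝ) : Prop :=
  ∀ x ∈ Ω,
    tderiv (tderiv ψ) t x - b * lap (tderiv ψ t) x - c ^ 2 * lap (ψ t) x = f t x

/-- The linearized Blackstock equation
ψ_tt − c²(1 − 2k α)Δψ − b Δψ_t + 2σ ∇ψ·∇α = f̃ holds at time `t` on `Ω`. -/
def IsLinBlackstock (Ω : Set (Spc d)) (b c k σ : ℝ) (α ψ f : ℝ → Spc d → ℝ) (t : ℝ) : Prop :=
  ∀ x ∈ Ω,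
    tderiv (tderiv ψ) t x - c ^ 2 * (1 - 2 * k * α t x) * lap (ψ t) x
      - b * lap (tderiv ψ t) x + 2 * σ * gdot (ψ t) (α t) x = f t x

/-- Time-weighted norm N_T^v for the velocity variable. -/
def normV (Ω : Set (Spc d)) (T : ℝ) (α : ℝ → Spc d → ℝ) : ℝ :=
  supIcc T (fun t => Real.sqrt (sqH1 Ω (α t)))
    + Real.sqrt (∫ t in (0:ℝ)..T, (sqL2 Ω (α t) + sqGrad Ω (α t) + sqL2 Ω (lap (α t))))
    + Real.sqrt (∫ t in (0:ℝ)..T, sqL2 Ω (tderiv α t))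
    + supIcc T (fun t => Real.sqrt t * Real.sqrt (sqL2 Ω (tderiv α t)))
    + Real.sqrt (∫ t in (0:ℝ)..T, t * sqGrad Ω (tderiv α t))
    + supIcc T (fun t => Real.sqrt t * Real.sqrt (sqL2 Ω (lap (α t))))

/-- Time-weighted solution norm N_T(ψ) = sup_{[0,T]} ‖ψ(t)‖_{H²} + N_T^v(ψ_t). -/
def normX (Ω : Set (Spc d)) (T : ℝ) (ψ : ℝ → Spc d → ℝ) : ℝ :=
  supIcc T (fun t => Real.sqrt (sqH2 Ω (ψ t))) + normV Ω T (tderiv ψ)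


theorem adm_dir {Ω : Set (Spc d)} {w : ℝ → Spc d → ℝ} (h : Admissible Ω w) (t : ℝ) (x : Spc d) :
    HasDerivAt (fun s => w s x)
      (fderiv ℝ (fun p : ℝ × Spc d => w p.1 p.2) (t, x) (1, 0)) t := by
  have h1 : HasFDerivAt (fun p : ℝ × Spc d => w p.1 p.2) _ (t, x) :=
    (h.1.differentiable (by simp) (t, x)).hasFDerivAt
  have h2 : HasDerivAt (fun s : ℝ => (s, x)) ((1 : ℝ), (0 : Spc d)) t :=
    (hasDerivAt_id t).prodMk (hasDerivAt_const t x)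
  exact h1.comp_hasDerivAt t h2

theorem adm_fd {Ω : Set (Spc d)} {w : ℝ → Spc d → ℝ} (h : Admissible Ω w) (t : ℝ) (x e : Spc d) :
    fderiv ℝ (w t) x e = fderiv ℝ (fun p : ℝ × Spc d => w p.1 p.2) (t, x) (0, e) := by
  have h1 : HasFDerivAt (fun p : ℝ × Spc d => w p.1 p.2) _ (t, x) :=
    (h.1.differentiable (by simp) (t, x)).hasFDerivAt
  have h2 : HasFDerivAt (fun y : Spc d => (t, y))
      ((0 : Spc d →L[ℝ] ℝ).prod (ContinuousLinearMap.id ℝ (Spc d))) x :=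
    (hasFDerivAt_const t x).prodMk (hasFDerivAt_id x)
  have h3 : HasFDerivAt (w t) _ x := h1.comp x h2
  rw [h3.fderiv]
  simp

theorem tderiv_eq {Ω : Set (Spc d)} {w : ℝ → Spc d → ℝ} (h : Admissible Ω w) (t : ℝ) (x : Spc d) :
    tderiv w t x = fderiv ℝ (fun p : ℝ × Spc d => w p.1 p.2) (t, x) (1, 0) :=
  (adm_dir h t x).deriv

theorem adm_slice {Ω : Set (Spc d)} {w : ℝ → Spc d → ℝ} (h : Admissible Ω w) (t : ℝ) :
    ContDiff ℝ (⊤ : ℕ∞) (w t) :=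
  h.1.comp (contDiff_const.prodMk contDiff_id)

theorem smooth_dir {W : ℝ × Spc d → ℝ} (h : ContDiff ℝ (⊤ : ℕ∞) W) (v : ℝ × Spc d) :
    ContDiff ℝ (⊤ : ℕ∞) (fun p => fderiv ℝ W p v) :=
  (h.fderiv_right (m := (⊤ : ℕ∞)) (by simp)).clm_apply contDiff_const

theorem adm_tderiv {Ω : Set (Spc d)} {w : ℝ → Spc d → ℝ} (h : Admissible Ω w) :
    Admissible Ω (tderiv w) := by
  refine ⟨?_, ?_⟩
  · have := smooth_dir h.1 (1, 0)
    have e2 : (fun p : ℝ × Spc d => tderiv w p.1 p.2) =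
        fun p => fderiv ℝ (fun p : ℝ × Spc d => w p.1 p.2) p (1, 0) := by
      funext p; exact tderiv_eq h _ _
    rw [e2]; exact this
  · obtain ⟨K, hK, hKΩ, hs⟩ := h.2
    refine ⟨K, hK, hKΩ, fun t x hx => ?_⟩
    by_contra hxK
    apply hx
    have : (fun s => w s x) = fun _ => 0 := by
      funext s
      by_contra h0
      exact hxK (hs s h0)
    simp [tderiv, this]

theorem adm_space {Ω : Set (Spc d)} {w : ℝ → Spc d → ℝ} (h : Admissible Ω w) (e : Spc d) :
    Admissible Ω (fun t x => fderiv ℝ (w t) x e) := by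
  refine ⟨?_, ?_⟩
  · have := smooth_dir h.1 (0, e)
    have e1 : (fun p : ℝ × Spc d => fderiv ℝ (w p.1) p.2 e) =
        fun p => fderiv ℝ (fun p : ℝ × Spc d => w p.1 p.2) p (0, e) := by
      funext p; exact adm_fd h _ _ _
    rw [e1]; exact this
  · obtain ⟨K, hK, hKΩ, hs⟩ := h.2
    refine ⟨K, hK, hKΩ, fun t x hx => ?_⟩
    have h1 : x ∈ Function.support (fderiv ℝ (w t)) := by
      intro h0
      apply hx
      simp [h0]
    exact closure_minimal (hs t) hK.isClosed (support_fderiv_subset ℝ h1)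

theorem adm_comm {Ω : Set (Spc d)} {w : ℝ → Spc d → ℝ} (h : Admissible Ω w) (e : Spc d)
    (t : ℝ) (x : Spc d) :
    tderiv (fun t x => fderiv ℝ (w t) x e) t x = fderiv ℝ (tderiv w t) x e := by
  rw [tderiv_eq (adm_space h e), adm_fd (adm_tderiv h)]
  have e1 : (fun p : ℝ × Spc d => fderiv ℝ (w p.1) p.2 e) =
      fun p => fderiv ℝ (fun p : ℝ × Spc d => w p.1 p.2) p (0, e) := by
    funext p; exact adm_fd h _ _ _
  have e2 : (fun p : ℝ × Spc d => tderiv w p.1 p.2) =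
      fun p => fderiv ℝ (fun p : ℝ × Spc d => w p.1 p.2) p (1, 0) := by
    funext p; exact tderiv_eq h _ _
  rw [e1, e2]
  have hd : DifferentiableAt ℝ (fderiv ℝ (fun p : ℝ × Spc d => w p.1 p.2)) (t, x) :=
    ((h.1.fderiv_right (m := (⊤ : ℕ∞)) (by simp)).differentiable (by simp)) _
  rw [fderiv_clm_apply hd (differentiableAt_const _), fderiv_clm_apply hd (differentiableAt_const _)]
  have hsym := (h.1.contDiffAt (x := (t, x))).isSymmSndFDerivAt (by
    rw [minSmoothness_of_isRCLikeNormedField]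
    exact WithTop.coe_le_coe.2 (le_top : (2 : ℕ∞) ≤ ⊤))
  simpa using hsym (1, 0) (0, e)

theorem adm_mul {Ω : Set (Spc d)} {v w : ℝ → Spc d → ℝ} (hv : Admissible Ω v)
    (h : Admissible Ω w) : Admissible Ω (fun t x => v t x * w t x) := by
  refine ⟨hv.1.mul h.1, ?_⟩
  obtain ⟨K, hK, hKΩ, hs⟩ := h.2
  refine ⟨K, hK, hKΩ, fun t x hx => hs t ?_⟩
  intro h0
  apply hx
  simp [h0]

theorem adm_add {Ω : Set (Spc d)} {v w : ℝ → Spc d → ℝ} (hv : Admissible Ω v)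
    (h : Admissible Ω w) : Admissible Ω (fun t x => v t x + w t x) := by
  refine ⟨hv.1.add h.1, ?_⟩
  obtain ⟨K, hK, hKΩ, hs⟩ := h.2
  obtain ⟨K', hK', hKΩ', hs'⟩ := hv.2
  refine ⟨K' ∪ K, hK'.union hK, Set.union_subset hKΩ' hKΩ, fun t x hx => ?_⟩
  by_contra hn
  rw [Set.mem_union, not_or] at hn
  apply hx
  have h1 : v t x = 0 := by by_contra h0; exact hn.1 (hs' t h0)
  have h2 : w t x = 0 := by by_contra h0; exact hn.2 (hs t h0)
  simp [h1, h2]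

theorem adm_smul {Ω : Set (Spc d)} {w : ℝ → Spc d → ℝ} (a : ℝ)
    (h : Admissible Ω w) : Admissible Ω (fun t x => a * w t x) := by
  refine ⟨contDiff_const.mul h.1, ?_⟩
  obtain ⟨K, hK, hKΩ, hs⟩ := h.2
  refine ⟨K, hK, hKΩ, fun t x hx => hs t ?_⟩
  intro h0
  apply hx
  simp [h0]

theorem adm_sum {Ω : Set (Spc d)} {ι : Type} (s : Finset ι) {w : ι → ℝ → Spc d → ℝ}
    (h : ∀ i, Admissible Ω (w i)) : Admissible Ω (fun t x => ∑ i ∈ s, w i t x) := by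
  classical
  induction s using Finset.induction_on with
  | empty =>
    exact ⟨by simpa using contDiff_const, ∅, isCompact_empty, Set.empty_subset _, by simp⟩
  | insert a s ha ih =>
    simp only [Finset.sum_insert ha]
    exact adm_add (h a) ih

theorem adm_cs {Ω : Set (Spc d)} {w : ℝ → Spc d → ℝ} (h : Admissible Ω w) (t : ℝ) :
    HasCompactSupport (w t) := by
  obtain ⟨K, hK, hKΩ, hs⟩ := h.2
  exact HasCompactSupport.of_support_subset_isCompact hK (hs t)

theorem adm_int {Ω : Set (Spc d)} {w : ℝ → Spc d → ℝ} (h : Admissible Ω w) (t : ℝ) :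
    Integrable (w t) :=
  (adm_slice h t).continuous.integrable_of_hasCompactSupport (adm_cs h t)

theorem adm_setInt {Ω : Set (Spc d)} {w : ℝ → Spc d → ℝ} (h : Admissible Ω w) (t : ℝ) :
    ∫ x in Ω, w t x = ∫ x, w t x := by
  obtain ⟨K, hK, hKΩ, hs⟩ := h.2
  apply setIntegral_eq_integral_of_forall_compl_eq_zero
  intro x hx
  by_contra h0
  exact hx (hKΩ (hs t h0))

/-- Integration by parts. -/
theorem adm_ibp {Ω : Set (Spc d)} {v w : ℝ → Spc d → ℝ} (hv : Admissible Ω v)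
    (hw : Admissible Ω w) (e : Spc d) (t : ℝ) :
    ∫ x in Ω, v t x * fderiv ℝ (w t) x e = - ∫ x in Ω, fderiv ℝ (v t) x e * w t x := by
  rw [adm_setInt (adm_mul hv (adm_space hw e)) t, adm_setInt (adm_mul (adm_space hv e) hw) t]
  exact integral_mul_fderiv_eq_neg_fderiv_mul_of_integrable
    (adm_int (adm_mul (adm_space hv e) hw) t) (adm_int (adm_mul hv (adm_space hw e)) t)
    (adm_int (adm_mul hv hw) t)
    (fun x _ => (adm_slice hv t).differentiable (by simp) x)
    (fun x _ => (adm_slice hw t).differentiable (by simp) x)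

theorem adm_deriv_int {Ω : Set (Spc d)} {w : ℝ → Spc d → ℝ} (h : Admissible Ω w)
    (hop : IsOpen Ω) (hbd : Bornology.IsBounded Ω) (t : ℝ) :
    HasDerivAt (fun s => ∫ x in Ω, w s x) (∫ x in Ω, tderiv w t x) t := by
  have ht := adm_tderiv h
  obtain ⟨K, hK, hKΩ, hs⟩ := ht.2
  have hc : IsCompact (Set.Icc (t - 1) (t + 1) ×ˢ K) := isCompact_Icc.prod hK
  obtain ⟨C, hC⟩ := hc.exists_bound_of_continuousOn ht.1.continuous.continuousOn
  haveI : IsFiniteMeasure (volume.restrict Ω) := ⟨by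
    simpa using hbd.measure_lt_top⟩
  have := hasDerivAt_integral_of_dominated_loc_of_deriv_le (μ := volume.restrict Ω)
    (F := w) (F' := tderiv w) (x₀ := t) (s := Metric.ball t 1) (bound := fun _ => max C 0)
    (Metric.ball_mem_nhds t one_pos)
    (Filter.Eventually.of_forall fun s => (adm_int h s).integrableOn.aestronglyMeasurable)
    (adm_int h t).integrableOn
    (adm_int ht t).integrableOn.aestronglyMeasurable
    (Filter.Eventually.of_forall fun x s hsb => by
      by_cases hx : x ∈ K
      · refine (hC (s, x) ⟨?_, hx⟩).trans (le_max_left _ _)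
        rw [Metric.mem_ball, Real.dist_eq, abs_lt] at hsb
        constructor <;> linarith [hsb.1, hsb.2]
      · have : tderiv w s x = 0 := by by_contra h0; exact hx (hs s h0)
        simp [this])
    (integrable_const _)
    (Filter.Eventually.of_forall fun x s _ => by
      rw [tderiv_eq h]; exact adm_dir h s x)
  exact this.2

theorem norm_grad_sq (g : Spc d → ℝ) (x : Spc d) :
    ‖gradient g x‖ ^ 2 = ∑ i, fderiv ℝ g x (EuclideanSpace.single i 1)
      * fderiv ℝ g x (EuclideanSpace.single i 1) := by
  rw [EuclideanSpace.real_norm_sq_eq]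
  refine Finset.sum_congr rfl fun i _ => ?_
  have : gradient g x i = fderiv ℝ g x (EuclideanSpace.single i 1) := by
    rw [← InnerProductSpace.toDual_symm_apply (𝕜 := ℝ)]
    rw [EuclideanSpace.inner_single_right]
    simp [gradient]
  rw [this, sq]

theorem adm_lap {Ω : Set (Spc d)} {w : ℝ → Spc d → ℝ} (h : Admissible Ω w) :
    Admissible Ω (fun t x => lap (w t) x) :=
  adm_sum _ fun i => adm_space (adm_space h (EuclideanSpace.single i 1)) (EuclideanSpace.single i 1)

/-- Green's identity. -/
theorem adm_green {Ω : Set (Spc d)} {v w : ℝ → Spc d → ℝ} (hv : Admissible Ω v)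
    (hw : Admissible Ω w) (t : ℝ) :
    ∫ x in Ω, v t x * lap (w t) x = - ∫ x in Ω, ∑ i, fderiv ℝ (v t) x (EuclideanSpace.single i 1)
      * fderiv ℝ (w t) x (EuclideanSpace.single i 1) := by
  simp only [lap, Finset.mul_sum]
  rw [integral_finsetSum, integral_finsetSum, ← Finset.sum_neg_distrib]
  · exact Finset.sum_congr rfl fun i _ => adm_ibp hv (adm_space hw _) _ t
  · exact fun i _ => (adm_int (adm_mul (adm_space hv _) (adm_space hw _)) t).integrableOn
  · exact fun i _ => (adm_int (adm_mul hv (adm_space (adm_space hw _) _)) t).integrableOn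

/-- the identity F₁′(t) + c²‖∇ψ‖² = ‖ψ_t‖² + ∫ f ψ
for solutions of the Blackstock equation. -/
theorem blackstock_F1_identity (d : ℕ) (hd : d = 1 ∨ d = 2 ∨ d = 3)
    (Ω : Set (Spc d)) (hne : Ω.Nonempty) (hop : IsOpen Ω) (hbd : Bornology.IsBounded Ω)
    (b c k σ : ℝ) (hb : 0 < b) (hc : 0 < c)
    (I : Set ℝ) (hIo : IsOpen I) (hIc : I.OrdConnected)
    (ψ : ℝ → Spc d → ℝ) (hadm : Admissible Ω ψ)
    (hsol : ∀ t ∈ I, IsBlackstock Ω b c k σ ψ t) :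
    ∀ t ∈ I,
      HasDerivAt
        (fun s => ∫ x in Ω, (ψ s x * tderiv ψ s x + (b/2) * ‖gradient (ψ s) x‖ ^ 2))
        (sqL2 Ω (tderiv ψ t) + (∫ x in Ω, blackF c k σ ψ t x * ψ t x)
          - c ^ 2 * sqGrad Ω (ψ t)) t := by
  intro t ht
  have h1 := adm_tderiv hadm
  have h2 := adm_tderiv h1
  have hdi : ∀ i : Fin d, Admissible Ω (fun t x => fderiv ℝ (ψ t) x (EuclideanSpace.single i 1)) :=
    fun i => adm_space hadm _
  have hS := adm_sum Finset.univ (fun i => adm_mul (hdi i) (hdi i))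
  have hG := adm_add (adm_mul hadm h1) (adm_smul (b / 2) hS)
  have hM := adm_sum Finset.univ (fun i : Fin d =>
    adm_mul (hdi i) (adm_space h1 (EuclideanSpace.single i 1)))
  have key := adm_deriv_int hG hop hbd t
  simp only [sqL2, sqGrad, norm_grad_sq]
  convert key using 1
  have hder : ∀ x, tderiv (fun t x => ψ t x * tderiv ψ t x + b / 2 *
      ∑ i, fderiv ℝ (ψ t) x (EuclideanSpace.single i 1)
        * fderiv ℝ (ψ t) x (EuclideanSpace.single i 1)) t x
      = (tderiv ψ t x * tderiv ψ t x + ψ t x * tderiv (tderiv ψ) t x) + b *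
      ∑ i, fderiv ℝ (ψ t) x (EuclideanSpace.single i 1)
        * fderiv ℝ (tderiv ψ t) x (EuclideanSpace.single i 1) := by
    intro x
    have d0 : HasDerivAt (fun s => ψ s x) (tderiv ψ t x) t :=
      (adm_dir hadm t x).differentiableAt.hasDerivAt
    have d1 : HasDerivAt (fun s => tderiv ψ s x) (tderiv (tderiv ψ) t x) t :=
      (adm_dir h1 t x).differentiableAt.hasDerivAt
    have dd : ∀ i : Fin d, HasDerivAt (fun s => fderiv ℝ (ψ s) x (EuclideanSpace.single i 1))
        (fderiv ℝ (tderiv ψ t) x (EuclideanSpace.single i 1)) t := fun i => by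
      rw [← adm_comm hadm]
      exact (adm_dir (hdi i) t x).differentiableAt.hasDerivAt
    have := (d0.mul d1).add ((HasDerivAt.fun_sum
      (fun i (_ : i ∈ Finset.univ) => (dd i).mul (dd i))).const_mul (b / 2))
    refine this.deriv.trans ?_
    congr 1
    rw [Finset.mul_sum, Finset.mul_sum]
    refine Finset.sum_congr rfl fun i _ => ?_
    ring
  have hf : ∫ x in Ω, blackF c k σ ψ t x * ψ t x = ∫ x in Ω, ((ψ t x * tderiv (tderiv ψ) t x
      + (-b) * (ψ t x * lap (tderiv ψ t) x)) + (-c ^ 2) * (ψ t x * lap (ψ t) x)) := by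
    refine setIntegral_congr_fun hop.measurableSet fun x hx => ?_
    have := hsol t ht x hx
    simp only [blackF]
    linear_combination (-ψ t x) * this
  have i1 := (adm_int (adm_mul h1 h1) t).integrableOn (s := Ω)
  have i2 := (adm_int (adm_mul hadm h2) t).integrableOn (s := Ω)
  have i3 := (adm_int (adm_smul b hM) t).integrableOn (s := Ω)
  have i4 := (adm_int (adm_smul (-b) (adm_mul hadm (adm_lap h1))) t).integrableOn (s := Ω)
  have i5 := (adm_int (adm_smul (-c ^ 2) (adm_mul hadm (adm_lap hadm))) t).integrableOn (s := Ω)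
  have g1 := adm_green hadm h1 t
  have g2 := adm_green hadm hadm t
  simp only [hder]
  rw [hf, integral_add (Integrable.fun_add i2 i4) i5, integral_add i2 i4, integral_add (Integrable.fun_add i1 i2) i3,
    integral_add i1 i2, integral_const_mul, integral_const_mul, integral_const_mul, g1, g2]
  simp only [sq]
  ring
end
end

section
/- Let d ∈ {1,2,3}, let Ω ⊆ ℝ^d be a nonempty bounded open set, let b, c > 0 and k, σ ∈ ℝ. If ψ is admissible and solves the Blackstock equation ψ_tt − c²(1 − 2k ψ_t)Δψ − b Δψ_t + 2σ ∇ψ·∇ψ_t = 0 on an open time interval I × Ω, then for every t ∈ I the function F₂(t) := ∫_Ω (−Δψ(t) ψ_t(t) + (b/2)(Δψ(t))²) is differentiable and F₂′(t) + c² ∫_Ω (Δψ(t))² = ∫_Ω |∇ψ_t(t)|² − ∫_Ω Δψ(t) f(t), where f := −2k c² ψ_t Δψ − 2σ ∇ψ·∇ψ_t. -/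
open MeasureTheory Real

noncomputable section

variable {d : ℕ}

lemma aux_D_smooth {E : Type*} [NormedAddCommGroup E] [NormedSpace ℝ E] {W : E → ℝ}
    (hW : ContDiff ℝ (⊤ : ℕ∞) W) (v : E) :
    ContDiff ℝ (⊤ : ℕ∞) (fun q => fderiv ℝ W q v) :=
  (hW.fderiv_right (m := (⊤ : ℕ∞)) (by simp)).clm_apply contDiff_const

lemma aux_D_comm {E : Type*} [NormedAddCommGroup E] [NormedSpace ℝ E] {W : E → ℝ}
    (hW : ContDiff ℝ (⊤ : ℕ∞) W) (v w p : E) :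
    fderiv ℝ (fun q => fderiv ℝ W q v) p w = fderiv ℝ (fun q => fderiv ℝ W q w) p v := by
  have hd : DifferentiableAt ℝ (fderiv ℝ W) p :=
    ((hW.fderiv_right (m := (⊤ : ℕ∞)) (by simp)).differentiable (by simp)) p
  have h1 : ∀ u z : E, fderiv ℝ (fun q => fderiv ℝ W q u) p z
      = fderiv ℝ (fderiv ℝ W) p z u := by
    intro u z
    rw [fderiv_clm_apply hd (differentiableAt_const u)]
    simp
  rw [h1, h1]
  have hs : IsSymmSndFDerivAt ℝ W p := by
    refine (hW.contDiffAt).isSymmSndFDerivAt ?_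
    simp only [minSmoothness_of_isRCLikeNormedField]
    exact WithTop.coe_le_coe.2 (le_top : (2 : ℕ∞) ≤ ⊤)
  exact hs w v

lemma aux_slice_x {w : ℝ → Spc d → ℝ}
    (hW : ContDiff ℝ (⊤ : ℕ∞) (fun p : ℝ × Spc d => w p.1 p.2)) (t : ℝ) (x v : Spc d) :
    fderiv ℝ (w t) x v = fderiv ℝ (fun p : ℝ × Spc d => w p.1 p.2) (t, x) (0, v) := by
  have h1 : HasFDerivAt (fun p : ℝ × Spc d => w p.1 p.2) _ (t, x) :=
    (hW.differentiable (by simp) (t, x)).hasFDerivAt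
  have h2 : HasFDerivAt (fun y : Spc d => (t, y)) (ContinuousLinearMap.inr ℝ ℝ (Spc d)) x :=
    hasFDerivAt_prodMk_right t x
  have h3 := h1.comp x h2
  have h4 : HasFDerivAt (w t) _ x := h3
  rw [h4.fderiv]
  simp

lemma aux_slice_t {w : ℝ → Spc d → ℝ}
    (hW : ContDiff ℝ (⊤ : ℕ∞) (fun p : ℝ × Spc d => w p.1 p.2)) (t : ℝ) (x : Spc d) :
    HasDerivAt (fun s => w s x)
      (fderiv ℝ (fun p : ℝ × Spc d => w p.1 p.2) (t, x) (1, 0)) t := by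
  have h1 : HasFDerivAt (fun p : ℝ × Spc d => w p.1 p.2) _ (t, x) :=
    (hW.differentiable (by simp) (t, x)).hasFDerivAt
  have h2 : HasDerivAt (fun s : ℝ => (s, x)) ((1 : ℝ), (0 : Spc d)) t :=
    (hasDerivAt_id t).prodMk (hasDerivAt_const t x)
  exact h1.comp_hasDerivAt t h2

lemma aux_tderiv_eq {w : ℝ → Spc d → ℝ}
    (hW : ContDiff ℝ (⊤ : ℕ∞) (fun p : ℝ × Spc d => w p.1 p.2)) (t : ℝ) (x : Spc d) :
    tderiv w t x = fderiv ℝ (fun p : ℝ × Spc d => w p.1 p.2) (t, x) (1, 0) :=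
  (aux_slice_t hW t x).deriv

lemma aux_tderiv_smooth {w : ℝ → Spc d → ℝ}
    (hW : ContDiff ℝ (⊤ : ℕ∞) (fun p : ℝ × Spc d => w p.1 p.2)) :
    ContDiff ℝ (⊤ : ℕ∞) (fun p : ℝ × Spc d => tderiv w p.1 p.2) := by
  have : (fun p : ℝ × Spc d => tderiv w p.1 p.2)
      = fun p => fderiv ℝ (fun p : ℝ × Spc d => w p.1 p.2) p (1, 0) := by
    funext p
    exact aux_tderiv_eq hW p.1 p.2
  rw [this]
  exact aux_D_smooth hW _

/-- directional spatial derivative as a function of (t,x) -/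
lemma aux_xd_eq {w : ℝ → Spc d → ℝ}
    (hW : ContDiff ℝ (⊤ : ℕ∞) (fun p : ℝ × Spc d => w p.1 p.2)) (v : Spc d) :
    (fun p : ℝ × Spc d => fderiv ℝ (w p.1) p.2 v)
      = fun p => fderiv ℝ (fun p : ℝ × Spc d => w p.1 p.2) p (0, v) := by
  funext p
  exact aux_slice_x hW p.1 p.2 v

lemma aux_xd_smooth {w : ℝ → Spc d → ℝ}
    (hW : ContDiff ℝ (⊤ : ℕ∞) (fun p : ℝ × Spc d => w p.1 p.2)) (v : Spc d) :
    ContDiff ℝ (⊤ : ℕ∞) (fun p : ℝ × Spc d => fderiv ℝ (w p.1) p.2 v) := by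
  rw [aux_xd_eq hW v]
  exact aux_D_smooth hW _

/-- time and space derivatives commute -/
lemma aux_xt_comm {w : ℝ → Spc d → ℝ}
    (hW : ContDiff ℝ (⊤ : ℕ∞) (fun p : ℝ × Spc d => w p.1 p.2)) (v : Spc d) (t : ℝ) (x : Spc d) :
    tderiv (fun s y => fderiv ℝ (w s) y v) t x = fderiv ℝ (tderiv w t) x v := by
  rw [aux_tderiv_eq (w := fun s y => fderiv ℝ (w s) y v) (aux_xd_smooth hW v),
    aux_slice_x (aux_tderiv_smooth hW), aux_xd_eq hW v, aux_D_comm hW]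
  congr 2
  funext p
  exact (aux_tderiv_eq hW p.1 p.2).symm

lemma aux_lap_smooth {w : ℝ → Spc d → ℝ}
    (hW : ContDiff ℝ (⊤ : ℕ∞) (fun p : ℝ × Spc d => w p.1 p.2)) :
    ContDiff ℝ (⊤ : ℕ∞) (fun p : ℝ × Spc d => lap (w p.1) p.2) := by
  unfold lap
  refine ContDiff.sum fun i _ => ?_
  exact aux_xd_smooth (w := fun s y => fderiv ℝ (w s) y (EuclideanSpace.single i 1))
    (aux_xd_smooth hW _) _

lemma aux_lap_t {w : ℝ → Spc d → ℝ}
    (hW : ContDiff ℝ (⊤ : ℕ∞) (fun p : ℝ × Spc d => w p.1 p.2)) (t : ℝ) (x : Spc d) :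
    HasDerivAt (fun s => lap (w s) x) (lap (tderiv w t) x) t := by
  unfold lap
  refine HasDerivAt.fun_sum fun i _ => ?_
  have hs := aux_xd_smooth hW (EuclideanSpace.single i (1 : ℝ))
  have h := aux_slice_t (w := fun s y => fderiv ℝ
    (fun z => fderiv ℝ (w s) z (EuclideanSpace.single i 1)) y (EuclideanSpace.single i 1))
    (aux_xd_smooth (w := fun s y => fderiv ℝ (w s) y (EuclideanSpace.single i 1)) hs _) t x
  rw [← aux_tderiv_eq (w := fun s y => fderiv ℝ
    (fun z => fderiv ℝ (w s) z (EuclideanSpace.single i 1)) y (EuclideanSpace.single i 1))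
    (aux_xd_smooth (w := fun s y => fderiv ℝ (w s) y (EuclideanSpace.single i 1)) hs _),
    aux_xt_comm (w := fun s y => fderiv ℝ (w s) y (EuclideanSpace.single i 1)) hs] at h
  have h2 : tderiv (fun s y => fderiv ℝ (w s) y (EuclideanSpace.single i 1)) t
      = fun y => fderiv ℝ (tderiv w t) y (EuclideanSpace.single i 1) := by
    funext y
    exact aux_xt_comm hW _ t y
  rw [h2] at h
  exact h

lemma aux_intOn {Ω : Set (Spc d)} (hbd : Bornology.IsBounded Ω) {g : Spc d → ℝ}
    (hg : Continuous g) : IntegrableOn g Ω :=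
  (hg.continuousOn.integrableOn_compact hbd.isCompact_closure).mono_set subset_closure

lemma aux_diff_int {Ω : Set (Spc d)} (hop : IsOpen Ω) (hbd : Bornology.IsBounded Ω)
    {G : ℝ → Spc d → ℝ}
    (hG : ContDiff ℝ (⊤ : ℕ∞) (fun p : ℝ × Spc d => G p.1 p.2)) (t : ℝ) :
    HasDerivAt (fun s => ∫ x in Ω, G s x) (∫ x in Ω, tderiv G t x) t := by
  have hT := (aux_tderiv_smooth hG).continuous
  have hcs : ∀ {H : ℝ → Spc d → ℝ}, Continuous (fun p : ℝ × Spc d => H p.1 p.2) →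
      ∀ s, Continuous (H s) := by
    intro H hH s
    exact hH.comp (by fun_prop : Continuous fun y : Spc d => (s, y))
  obtain ⟨C, hC⟩ := ((isCompact_closedBall t 1).prod hbd.isCompact_closure).exists_bound_of_continuousOn
    hT.continuousOn
  refine (hasDerivAt_integral_of_dominated_loc_of_deriv_le (bound := fun _ => C)
    (Metric.closedBall_mem_nhds t one_pos) ?_ ?_ ?_ ?_ ?_ ?_).2
  · exact Filter.Eventually.of_forall fun s => (hcs hG.continuous s).aestronglyMeasurable
  · exact aux_intOn hbd (hcs hG.continuous t)
  · exact (hcs hT t).aestronglyMeasurable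
  · refine (ae_restrict_iff' hop.measurableSet).2 (Filter.Eventually.of_forall fun x hx s hs => ?_)
    exact hC (s, x) ⟨hs, subset_closure hx⟩
  · exact aux_intOn hbd continuous_const
  · refine Filter.Eventually.of_forall fun x s _ => ?_
    rw [aux_tderiv_eq hG]
    exact aux_slice_t hG s x

lemma aux_gradient_sq (g : Spc d → ℝ) (x : Spc d) :
    ‖gradient g x‖ ^ 2 = ∑ i, (fderiv ℝ g x (EuclideanSpace.single i 1)) ^ 2 := by
  rw [EuclideanSpace.norm_sq_eq]
  refine Finset.sum_congr rfl fun i _ => ?_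
  have : fderiv ℝ g x (EuclideanSpace.single i 1) = gradient g x i := by
    rw [gradient, ← InnerProductSpace.toDual_symm_apply, EuclideanSpace.inner_single_right]
    simp
  rw [this, Real.norm_eq_abs, sq_abs]

lemma aux_green {Ω K : Set (Spc d)} (hK : IsCompact K) (hKΩ : K ⊆ Ω) {g : Spc d → ℝ}
    (hg : ContDiff ℝ (⊤ : ℕ∞) g) (hs : Function.support g ⊆ K) :
    ∫ x in Ω, -(lap g x) * g x = sqGrad Ω g := by
  have hts : tsupport g ⊆ K := closure_minimal hs hK.isClosed
  have hcs : HasCompactSupport g := hK.of_isClosed_subset (isClosed_tsupport g) hts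
  have hg0 : ∀ x, x ∉ Ω → g x = 0 := fun x hx => by
    by_contra h
    exact hx (hKΩ (hs h))
  have hd0 : ∀ x, x ∉ Ω → ∀ v, fderiv ℝ g x v = 0 := fun x hx v => by
    have : fderiv ℝ g x = 0 := by
      by_contra h
      exact hx (hKΩ (hts (support_fderiv_subset ℝ h)))
    simp [this]
  unfold sqGrad
  rw [setIntegral_eq_integral_of_forall_compl_eq_zero (fun x hx => by simp [hg0 x hx]),
    setIntegral_eq_integral_of_forall_compl_eq_zero
      (fun x hx => by rw [aux_gradient_sq]; simp [hd0 x hx])]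
  simp only [aux_gradient_sq, lap]
  have hsm := fun i : Fin d => aux_D_smooth hg (EuclideanSpace.single i (1 : ℝ))
  have hsm2 := fun i : Fin d => aux_D_smooth (hsm i) (EuclideanSpace.single i (1 : ℝ))
  have hcd : ∀ i : Fin d, HasCompactSupport
      (fun x => fderiv ℝ g x (EuclideanSpace.single i (1 : ℝ))) :=
    fun i => hcs.fderiv_apply (𝕜 := ℝ) _
  have i1 : ∀ i : Fin d, Integrable (fun x => fderiv ℝ g x (EuclideanSpace.single i (1 : ℝ))
      * fderiv ℝ g x (EuclideanSpace.single i (1 : ℝ))) := fun i =>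
    ((hsm i).continuous.mul (hsm i).continuous).integrable_of_hasCompactSupport
      (hcd i).mul_right
  have i2 : ∀ i : Fin d, Integrable (fun x => g x * fderiv ℝ
      (fun y => fderiv ℝ g y (EuclideanSpace.single i (1 : ℝ))) x
        (EuclideanSpace.single i (1 : ℝ))) := fun i =>
    (hg.continuous.mul (hsm2 i).continuous).integrable_of_hasCompactSupport hcs.mul_right
  have i3 : ∀ i : Fin d, Integrable (fun x => g x *
      fderiv ℝ g x (EuclideanSpace.single i (1 : ℝ))) := fun i =>
    (hg.continuous.mul (hsm i).continuous).integrable_of_hasCompactSupport hcs.mul_right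
  have key := fun i : Fin d => integral_mul_fderiv_eq_neg_fderiv_mul_of_integrable
    (i1 i) (i2 i) (i3 i)
    (fun x _ => (hg.differentiable (by simp)) x)
    (fun x _ => ((hsm i).differentiable (by simp)) x)
  have e1 : ∀ x, -(∑ i : Fin d, fderiv ℝ (fun y => fderiv ℝ g y (EuclideanSpace.single i (1 : ℝ))) x
        (EuclideanSpace.single i (1 : ℝ))) * g x
      = ∑ i : Fin d, -(g x * fderiv ℝ (fun y => fderiv ℝ g y (EuclideanSpace.single i (1 : ℝ))) x
        (EuclideanSpace.single i (1 : ℝ))) := by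
    intro x
    rw [Finset.sum_neg_distrib, ← Finset.mul_sum]
    ring
  simp only [e1]
  rw [integral_finsetSum _ (fun i _ => (i2 i).fun_neg),
    integral_finsetSum _ (fun i _ => by simpa only [pow_two] using i1 i)]
  refine Finset.sum_congr rfl fun i _ => ?_
  rw [integral_neg, key i, neg_neg]
  simp only [pow_two]

/-- the identity F₂′(t) + c²‖Δψ‖² = ‖∇ψ_t‖² − ∫ Δψ f
for solutions of the Blackstock equation. -/
theorem blackstock_F2_identity (d : ℕ) (hd : d = 1 ∨ d = 2 ∨ d = 3)
    (Ω : Set (Spc d)) (hne : Ω.Nonempty) (hop : IsOpen Ω) (hbd : Bornology.IsBounded Ω)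
    (b c k σ : ℝ) (hb : 0 < b) (hc : 0 < c)
    (I : Set ℝ) (hIo : IsOpen I) (hIc : I.OrdConnected)
    (ψ : ℝ → Spc d → ℝ) (hadm : Admissible Ω ψ)
    (hsol : ∀ t ∈ I, IsBlackstock Ω b c k σ ψ t) :
    ∀ t ∈ I,
      HasDerivAt
        (fun s => ∫ x in Ω, (-(lap (ψ s) x) * tderiv ψ s x + (b/2) * (lap (ψ s) x) ^ 2))
        (sqGrad Ω (tderiv ψ t) - (∫ x in Ω, lap (ψ t) x * blackF c k σ ψ t x)
          - c ^ 2 * sqL2 Ω (lap (ψ t))) t := by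
  intro t ht
  obtain ⟨hW, K, hK, hKΩ, hsupp⟩ := hadm
  have hT := aux_tderiv_smooth hW
  have hTT := aux_tderiv_smooth hT
  have hL := aux_lap_smooth hW
  have hLT := aux_lap_smooth hT
  have hsl : Continuous fun y : Spc d => (t, y) := by fun_prop
  have cT : Continuous (tderiv ψ t) := hT.continuous.comp hsl
  have cTT : Continuous (tderiv (tderiv ψ) t) := hTT.continuous.comp hsl
  have cL : Continuous (lap (ψ t)) := hL.continuous.comp hsl
  have cLT : Continuous (lap (tderiv ψ t)) := hLT.continuous.comp hsl
  have hG : ContDiff ℝ (⊤ : ℕ∞) (fun p : ℝ × Spc d =>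
      -(lap (ψ p.1) p.2) * tderiv ψ p.1 p.2 + (b/2) * (lap (ψ p.1) p.2) ^ 2) :=
    (hL.neg.mul hT).add (contDiff_const.mul (hL.pow 2))
  have hmain := aux_diff_int (G := fun s x =>
    -(lap (ψ s) x) * tderiv ψ s x + (b/2) * (lap (ψ s) x) ^ 2) hop hbd hG t
  convert hmain using 1
  have hder : ∀ x, tderiv (fun s x =>
      -(lap (ψ s) x) * tderiv ψ s x + (b/2) * (lap (ψ s) x) ^ 2) t x
      = -(lap (tderiv ψ t) x) * tderiv ψ t x
        - lap (ψ t) x * (tderiv (tderiv ψ) t x - b * lap (tderiv ψ t) x) := by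
    intro x
    have h1 := aux_lap_t hW t x
    have h2 : HasDerivAt (fun s => tderiv ψ s x) (tderiv (tderiv ψ) t x) t := by
      rw [aux_tderiv_eq hT]
      exact aux_slice_t hT t x
    have h3 := (h1.fun_neg.fun_mul h2).fun_add ((h1.fun_pow 2).const_mul (b/2))
    refine h3.deriv.trans ?_
    push_cast
    ring
  have hsupT : Function.support (tderiv ψ t) ⊆ K := by
    intro x hx
    by_contra hxK
    refine hx ?_
    have : (fun s => ψ s x) = fun _ => 0 := by
      funext s
      by_contra h
      exact hxK (hsupp s h)
    simp [tderiv, this]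
  have hgreen := aux_green hK hKΩ
    (hT.comp (contDiff_const.prodMk contDiff_id : ContDiff ℝ (⊤ : ℕ∞) fun y : Spc d => (t, y)))
    hsupT
  change ∫ x in Ω, -(lap (tderiv ψ t) x) * tderiv ψ t x = sqGrad Ω (tderiv ψ t) at hgreen
  have hF : ∫ x in Ω, lap (ψ t) x * blackF c k σ ψ t x
      = ∫ x in Ω, (lap (ψ t) x * (tderiv (tderiv ψ) t x - b * lap (tderiv ψ t) x)
        - c ^ 2 * (lap (ψ t) x) ^ 2) := by
    refine setIntegral_congr_fun hop.measurableSet fun x hx => ?_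
    have := hsol t ht x hx
    simp only [blackF]
    linear_combination (-lap (ψ t) x) * this
  simp only [hder]
  rw [hF, ← hgreen, sqL2, integral_sub (aux_intOn hbd (by fun_prop)) (aux_intOn hbd (by fun_prop)),
    integral_sub (aux_intOn hbd (by fun_prop)) (aux_intOn hbd (by fun_prop)),
    integral_const_mul]
  ring
end
end

section
/- Let d ∈ {1,2,3}, let Ω ⊆ ℝ^d be a nonempty bounded open set and let b, c > 0. There exist constants γ₁, γ₂, γ₃ > 0 and C₁, C₂ > 0 (depending only on d, Ω, b, c) such that for every pair of C^∞ functions u, w : ℝ^d → ℝ with compact support contained in Ω, the quantities E := ½‖w‖² + (c²/2)‖∇u‖² + (c²/(2b))‖Δu‖² + ‖∇w‖² and L := ½‖w‖² + (c²/2)‖∇u‖² + γ₁(c²/(2b))‖Δu‖² + γ₂ ∫_Ω (u w + (b/2)|∇u|²) + γ₂ ∫_Ω (−Δu·w + (b/2)(Δu)²) + γ₃ ∫_Ω (c² ∇u·∇w + (b/2)|∇w|²) satisfy C₁ E ≤ L ≤ C₂ E. -/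
open MeasureTheory Real

noncomputable section

variable {d : ℕ}

theorem aux_grad_cont {g : Spc d → ℝ} (hg : ContDiff ℝ (⊤ : ℕ∞) g) : Continuous (gradient g) := by
  unfold gradient
  exact (LinearIsometryEquiv.continuous _).comp (hg.continuous_fderiv (by simp))

theorem aux_grad_zero {g : Spc d → ℝ} {x : Spc d} (hx : x ∉ tsupport g) : gradient g x = 0 := by
  unfold gradient
  rw [fderiv_of_notMem_tsupport (𝕜 := ℝ) hx]
  simp

theorem aux_lap_cont {g : Spc d → ℝ} (hg : ContDiff ℝ (⊤ : ℕ∞) g) : Continuous (lap g) := by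
  unfold lap
  refine continuous_finsetSum _ fun i _ => ?_
  have h1 : ContDiff ℝ (⊤ : ℕ∞) (fun y => fderiv ℝ g y (EuclideanSpace.single i 1)) :=
    (hg.fderiv_right (m := (⊤ : ℕ∞)) (by simp)).clm_apply contDiff_const
  exact (h1.continuous_fderiv (by simp)).clm_apply continuous_const

theorem aux_lap_zero {g : Spc d → ℝ} {x : Spc d} (hx : x ∉ tsupport g) : lap g x = 0 := by
  unfold lap
  refine Finset.sum_eq_zero fun i _ => ?_
  rw [fderiv_of_notMem_tsupport (𝕜 := ℝ)
    (fun h => hx (tsupport_fderiv_apply_subset ℝ (EuclideanSpace.single i (1:ℝ)) h))]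
  simp

theorem aux_int {K : Set (Spc d)} (hK : IsCompact K) {F : Spc d → ℝ} (hF : Continuous F)
    (h0 : ∀ x, x ∉ K → F x = 0) : Integrable F :=
  hF.integrable_of_hasCompactSupport (HasCompactSupport.intro hK h0)

/-- Young inequality for integrals. -/
theorem aux_young {F P Q : Spc d → ℝ} {Ω : Set (Spc d)} (hF : Integrable F) (hP : Integrable P)
    (hQ : Integrable Q) (s t : ℝ) (h : ∀ x, s * F x ≤ t * P x + Q x) :
    s * (∫ x in Ω, F x) ≤ t * (∫ x in Ω, P x) + ∫ x in Ω, Q x := by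
  rw [← integral_const_mul, ← integral_const_mul, ← integral_add (hP.integrableOn.const_mul t)
    hQ.integrableOn]
  exact integral_mono (hF.integrableOn.const_mul s)
    ((hP.integrableOn.const_mul t).add hQ.integrableOn) h

theorem aux_poincare (i : Fin d) {Ω : Set (Spc d)} {R : ℝ} (hR : ∀ x ∈ Ω, ‖x‖ ≤ R)
    {u : Spc d → ℝ} (hu : ContDiff ℝ (⊤ : ℕ∞) u) (hc : HasCompactSupport u)
    (hs : tsupport u ⊆ Ω) : sqL2 Ω u ≤ 4 * R ^ 2 * sqGrad Ω u := by
  have hz : ∀ x, x ∉ tsupport u → u x = 0 := fun x hx => image_eq_zero_of_notMem_tsupport hx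
  have hgz : ∀ x, x ∉ tsupport u → gradient u x = 0 := fun x hx => aux_grad_zero hx
  have hgc := aux_grad_cont hu
  have huc := hu.continuous
  set e : Spc d := EuclideanSpace.single i 1 with he
  have hxc : Continuous (fun x : Spc d => x i) := by fun_prop
  have hfd : ∀ x, fderiv ℝ u x e = inner ℝ (gradient u x) e := fun x => by
    rw [inner_gradient_left]
  have hne : ‖e‖ = 1 := by simp [he]
  have hdu : ∀ x, DifferentiableAt ℝ u x := fun x => (hu.differentiable (by simp)) x
  have hproj : ∀ x : Spc d, HasFDerivAt (fun x : Spc d => x i)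
      (EuclideanSpace.proj i : Spc d →L[ℝ] ℝ) x := fun x =>
    (EuclideanSpace.proj i : Spc d →L[ℝ] ℝ).hasFDerivAt
  have hf : ∀ x, fderiv ℝ (fun x : Spc d => x i * u x) x e
      = x i * inner ℝ (gradient u x) e + u x := fun x => by
    have h1 : HasFDerivAt (fun x : Spc d => x i * u x) _ x :=
      (hproj x).mul (hdu x).hasFDerivAt
    rw [h1.fderiv]
    simp only [ContinuousLinearMap.add_apply, ContinuousLinearMap.smul_apply, hfd]
    simp [he]
  have I1 : Integrable (fun x => (x i * inner ℝ (gradient u x) e + u x) * u x) :=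
    aux_int hc (by fun_prop) (fun x hx => by simp [hz x hx])
  have I2 : Integrable (fun x => (x i * u x) * inner ℝ (gradient u x) e) :=
    aux_int hc (by fun_prop) (fun x hx => by simp [hz x hx])
  have I3 : Integrable (fun x => (x i * u x) * u x) :=
    aux_int hc (by fun_prop) (fun x hx => by simp [hz x hx])
  have I4 : Integrable (fun x => (u x) ^ 2) :=
    aux_int hc (by fun_prop) (fun x hx => by simp [hz x hx])
  have I5 : Integrable (fun x => ‖gradient u x‖ ^ 2) :=
    aux_int hc (by fun_prop) (fun x hx => by simp [hgz x hx])
  have key := integral_mul_fderiv_eq_neg_fderiv_mul_of_integrable (μ := (volume : Measure (Spc d)))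
    (f := fun x : Spc d => x i * u x) (g := u) (v := e)
    (by simpa only [hf] using I1) (by simpa only [hfd] using I2) I3
    (fun x _ => (hproj x).differentiableAt.mul (hdu x)) (fun x _ => hdu x)
  simp only [hf, hfd] at key
  have e1 : sqL2 Ω u = ∫ x, (u x) ^ 2 :=
    setIntegral_eq_integral_of_forall_compl_eq_zero fun x hx => by simp [hz x (fun h => hx (hs h))]
  have e2 : sqGrad Ω u = ∫ x, ‖gradient u x‖ ^ 2 :=
    setIntegral_eq_integral_of_forall_compl_eq_zero fun x hx => by simp [hgz x (fun h => hx (hs h))]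
  have e3 : ∫ x, (x i * inner ℝ (gradient u x) e + u x) * u x
      = (∫ x, (x i * u x) * inner ℝ (gradient u x) e) + ∫ x, (u x) ^ 2 := by
    rw [← integral_add I2 I4]
    congr 1; ext x; ring
  have e4 : ∫ x, (-2) * ((x i * u x) * inner ℝ (gradient u x) e)
      ≤ ∫ x, ((1/2) * (u x) ^ 2 + 2 * R ^ 2 * ‖gradient u x‖ ^ 2) := by
    refine integral_mono (I2.const_mul _) ((I4.const_mul _).add (I5.const_mul _)) fun x => ?_
    by_cases hx : x ∈ tsupport u
    · have hxR : |x i| ≤ R := (by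
        simpa only [norm_eq_abs] using PiLp.norm_apply_le x i : |x i| ≤ ‖x‖).trans (hR x (hs hx))
      have hin : |inner ℝ (gradient u x) e| ≤ ‖gradient u x‖ := by
        simpa [hne] using abs_real_inner_le_norm (gradient u x) e
      have h2 : (x i * inner ℝ (gradient u x) e) ^ 2 ≤ R ^ 2 * ‖gradient u x‖ ^ 2 := by
        rw [mul_pow]
        exact mul_le_mul (sq_le_sq' (abs_le.1 hxR).1 (abs_le.1 hxR).2)
          (sq_le_sq' (abs_le.1 hin).1 (abs_le.1 hin).2) (sq_nonneg _) (sq_nonneg _)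
      simp only
      nlinarith [sq_nonneg (u x + 2 * (x i * inner ℝ (gradient u x) e))]
    · simp [hz x hx]; positivity
  rw [integral_const_mul, integral_add (I4.const_mul _) (I5.const_mul _), integral_const_mul,
    integral_const_mul] at e4
  rw [e1, e2]
  linarith

/-- equivalence of the Lyapunov functional L and the energy E. -/
theorem lyapunov_equivalence (d : ℕ) (hd : d = 1 ∨ d = 2 ∨ d = 3)
    (Ω : Set (Spc d)) (hne : Ω.Nonempty) (hop : IsOpen Ω) (hbd : Bornology.IsBounded Ω)
    (b c : ℝ) (hb : 0 < b) (hc : 0 < c) :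
    ∃ γ₁ > (0:ℝ), ∃ γ₂ > (0:ℝ), ∃ γ₃ > (0:ℝ), ∃ C₁ > (0:ℝ), ∃ C₂ > (0:ℝ),
      ∀ u w : Spc d → ℝ,
        ContDiff ℝ (⊤ : ℕ∞) u → HasCompactSupport u → tsupport u ⊆ Ω →
        ContDiff ℝ (⊤ : ℕ∞) w → HasCompactSupport w → tsupport w ⊆ Ω →
        C₁ * ((1/2) * sqL2 Ω w + (c ^ 2 / 2) * sqGrad Ω u
              + (c ^ 2 / (2 * b)) * sqL2 Ω (lap u) + sqGrad Ω w)
          ≤ (1/2) * sqL2 Ω w + (c ^ 2 / 2) * sqGrad Ω u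
              + γ₁ * (c ^ 2 / (2 * b)) * sqL2 Ω (lap u)
              + γ₂ * (∫ x in Ω, (u x * w x + (b/2) * ‖gradient u x‖ ^ 2))
              + γ₂ * (∫ x in Ω, (-(lap u x) * w x + (b/2) * (lap u x) ^ 2))
              + γ₃ * (∫ x in Ω, (c ^ 2 * gdot u w x + (b/2) * ‖gradient w x‖ ^ 2)) ∧
        (1/2) * sqL2 Ω w + (c ^ 2 / 2) * sqGrad Ω u
              + γ₁ * (c ^ 2 / (2 * b)) * sqL2 Ω (lap u)
              + γ₂ * (∫ x in Ω, (u x * w x + (b/2) * ‖gradient u x‖ ^ 2))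
              + γ₂ * (∫ x in Ω, (-(lap u x) * w x + (b/2) * (lap u x) ^ 2))
              + γ₃ * (∫ x in Ω, (c ^ 2 * gdot u w x + (b/2) * ‖gradient w x‖ ^ 2))
          ≤ C₂ * ((1/2) * sqL2 Ω w + (c ^ 2 / 2) * sqGrad Ω u
              + (c ^ 2 / (2 * b)) * sqL2 Ω (lap u) + sqGrad Ω w) := by
  have hd0 : 0 < d := by omega
  obtain ⟨R, hR⟩ := hbd.exists_norm_le
  set P : ℝ := 4 * R ^ 2 with hP
  have hP0 : 0 ≤ P := by positivity
  set K : ℝ := 16 * P + 8 * b + 1 with hK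
  have hK1 : 1 ≤ K := by linarith
  have hK0 : 0 < K := by linarith
  set g : ℝ := c / K with hg
  have hg0 : 0 < g := by positivity
  have hc2 : 0 < c ^ 2 := by positivity
  have hgK : g ^ 2 * K ≤ c ^ 2 := by
    have : g * K = c := by rw [hg]; field_simp
    have h2 : g ^ 2 * K ≤ g ^ 2 * K * K := le_mul_of_one_le_right (by positivity) hK1
    calc g ^ 2 * K ≤ g ^ 2 * K * K := h2
      _ = (g * K) ^ 2 := by ring
      _ = c ^ 2 := by rw [this]
  have hg2 : 0 < g ^ 2 := by positivity
  have hgP : 16 * (g ^ 2 * P) ≤ c ^ 2 := by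
    have : 0 < g ^ 2 * b := by positivity
    rw [hK] at hgK; nlinarith
  have hgb : 8 * (g ^ 2 * b) ≤ c ^ 2 := by
    have : 0 ≤ g ^ 2 * P := by positivity
    rw [hK] at hgK; nlinarith
  have hgb' : 2 * g ^ 2 ≤ c ^ 2 / (4 * b) := by
    rw [le_div_iff₀ (by positivity)]; linarith
  set k : ℝ := b ^ 2 / (16 * c ^ 2) with hk
  have hk0 : 0 < k := by positivity
  have hm0 : 0 < min (1/4) k := lt_min (by norm_num) hk0
  refine ⟨1, one_pos, g, hg0, b / (4 * c ^ 2), by positivity, min (1/4) k, hm0,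
    2 + g * b / c ^ 2 + g * b ^ 2 / c ^ 2 + 3 * k, by positivity, ?_⟩
  intro u w hu huc hus hw hwc hws
  have hz : ∀ x, x ∉ tsupport u → u x = 0 := fun x hx => image_eq_zero_of_notMem_tsupport hx
  have hgz : ∀ x, x ∉ tsupport u → gradient u x = 0 := fun x hx => aux_grad_zero hx
  have hlz : ∀ x, x ∉ tsupport u → lap u x = 0 := fun x hx => aux_lap_zero hx
  have hwz : ∀ x, x ∉ tsupport w → w x = 0 := fun x hx => image_eq_zero_of_notMem_tsupport hx
  have hwgz : ∀ x, x ∉ tsupport w → gradient w x = 0 := fun x hx => aux_grad_zero hx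
  have cgu := aux_grad_cont hu
  have cgw := aux_grad_cont hw
  have clu := aux_lap_cont hu
  have cu := hu.continuous
  have cw := hw.continuous
  have cgd : Continuous (gdot u w) := by unfold gdot; fun_prop
  have IU : Integrable (fun x => (u x) ^ 2) :=
    aux_int huc (by fun_prop) (fun x hx => by simp [hz x hx])
  have IW : Integrable (fun x => (w x) ^ 2) :=
    aux_int hwc (by fun_prop) (fun x hx => by simp [hwz x hx])
  have IG : Integrable (fun x => ‖gradient u x‖ ^ 2) :=
    aux_int huc (by fun_prop) (fun x hx => by simp [hgz x hx])
  have IH : Integrable (fun x => ‖gradient w x‖ ^ 2) :=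
    aux_int hwc (by fun_prop) (fun x hx => by simp [hwgz x hx])
  have IL : Integrable (fun x => (lap u x) ^ 2) :=
    aux_int huc (by fun_prop) (fun x hx => by simp [hlz x hx])
  have IA : Integrable (fun x => u x * w x) :=
    aux_int huc (by fun_prop) (fun x hx => by simp [hz x hx])
  have IB : Integrable (fun x => -(lap u x) * w x) :=
    aux_int huc (by fun_prop) (fun x hx => by simp [hlz x hx])
  have ID : Integrable (fun x => gdot u w x) :=
    aux_int huc cgd (fun x hx => by simp [gdot, hgz x hx])
  have s1 : ∫ x in Ω, (u x * w x + (b/2) * ‖gradient u x‖ ^ 2)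
      = (∫ x in Ω, u x * w x) + (b/2) * sqGrad Ω u := by
    rw [integral_add IA.integrableOn (IG.integrableOn.const_mul _), integral_const_mul]; rfl
  have s2 : ∫ x in Ω, (-(lap u x) * w x + (b/2) * (lap u x) ^ 2)
      = (∫ x in Ω, -(lap u x) * w x) + (b/2) * sqL2 Ω (lap u) := by
    rw [integral_add IB.integrableOn (IL.integrableOn.const_mul _), integral_const_mul]; rfl
  have s3 : ∫ x in Ω, (c ^ 2 * gdot u w x + (b/2) * ‖gradient w x‖ ^ 2)
      = c ^ 2 * (∫ x in Ω, gdot u w x) + (b/2) * sqGrad Ω w := by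
    rw [integral_add (ID.integrableOn.const_mul _) (IH.integrableOn.const_mul _),
      integral_const_mul, integral_const_mul]; rfl
  have yA : ∀ s : ℝ, 2 * s * (∫ x in Ω, u x * w x) ≤ s ^ 2 * sqL2 Ω u + sqL2 Ω w := fun s =>
    aux_young IA IU IW _ _ fun x => by nlinarith [sq_nonneg (s * u x - w x)]
  have yB : ∀ s : ℝ, 2 * s * (∫ x in Ω, -(lap u x) * w x)
      ≤ s ^ 2 * sqL2 Ω (lap u) + sqL2 Ω w := fun s =>
    aux_young IB IL IW _ _ fun x => by nlinarith [sq_nonneg (s * lap u x + w x)]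
  have yD : ∀ s : ℝ, 2 * s * (∫ x in Ω, gdot u w x) ≤ s ^ 2 * sqGrad Ω u + sqGrad Ω w := fun s =>
    aux_young ID IG IH _ _ fun x => by
      have h := norm_sub_sq_real (s • gradient u x) (gradient w x)
      rw [norm_smul, mul_pow, real_inner_smul_left, norm_eq_abs, sq_abs] at h
      have h' := sq_nonneg (‖s • gradient u x - gradient w x‖)
      unfold gdot
      linarith
  have pU : sqL2 Ω u ≤ P * sqGrad Ω u := aux_poincare ⟨0, hd0⟩ hR hu huc hus
  have nW : 0 ≤ sqL2 Ω w := integral_nonneg fun x => sq_nonneg _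
  have nG : 0 ≤ sqGrad Ω u := integral_nonneg fun x => sq_nonneg _
  have nL : 0 ≤ sqL2 Ω (lap u) := integral_nonneg fun x => sq_nonneg _
  have nH : 0 ≤ sqGrad Ω w := integral_nonneg fun x => sq_nonneg _
  rw [s1, s2, s3]
  generalize (∫ x in Ω, u x * w x) = A at *
  generalize (∫ x in Ω, -(lap u x) * w x) = B at *
  generalize (∫ x in Ω, gdot u w x) = D at *
  generalize sqL2 Ω u = U at *
  generalize sqL2 Ω w = W at *
  generalize sqGrad Ω u = G at *
  generalize sqL2 Ω (lap u) = L at *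
  generalize sqGrad Ω w = H at *
  -- bounds for the three cross terms
  have a0 : 2 * g ^ 2 * U ≤ c ^ 2 / 8 * G := by
    have h1 : g ^ 2 * U ≤ g ^ 2 * (P * G) := mul_le_mul_of_nonneg_left pU hg2.le
    have h2 : 16 * (g ^ 2 * P) * G ≤ c ^ 2 * G := mul_le_mul_of_nonneg_right hgP nG
    linarith
  have a1 : g * A ≤ W / 8 + c ^ 2 / 8 * G := by linarith [yA (4 * g)]
  have a2 : -(g * A) ≤ W / 8 + c ^ 2 / 8 * G := by linarith [yA (-(4 * g))]
  have b0 : 2 * g ^ 2 * L ≤ c ^ 2 / (4 * b) * L := mul_le_mul_of_nonneg_right hgb' nL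
  have b1 : g * B ≤ W / 8 + c ^ 2 / (4 * b) * L := by linarith [yB (4 * g)]
  have b2 : -(g * B) ≤ W / 8 + c ^ 2 / (4 * b) * L := by linarith [yB (-(4 * g))]
  have hkey : ∀ s : ℝ, s ^ 2 = (2 * c ^ 2 / b) ^ 2 → k * (2 * s * D) ≤ c ^ 2 / 4 * G + k * H := by
    intro s hs
    have h := mul_le_mul_of_nonneg_left (yD s) hk0.le
    have e : k * s ^ 2 = c ^ 2 / 4 := by rw [hs, hk]; field_simp; norm_num
    calc k * (2 * s * D) ≤ k * (s ^ 2 * G + H) := h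
      _ = (k * s ^ 2) * G + k * H := by ring
      _ = _ := by rw [e]
  have ek : k * (2 * (2 * c ^ 2 / b)) = b / 4 := by rw [hk]; field_simp; norm_num
  have d1 : b / 4 * D ≤ c ^ 2 / 4 * G + k * H := by
    have h := hkey _ rfl
    rwa [← mul_assoc, ek] at h
  have d2 : -(b / 4 * D) ≤ c ^ 2 / 4 * G + k * H := by
    have h := hkey (-(2 * c ^ 2 / b)) (by ring)
    have e : k * (2 * -(2 * c ^ 2 / b) * D) = -(k * (2 * (2 * c ^ 2 / b)) * D) := by ring
    rwa [e, ek] at h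
  have e3 : b / (4 * c ^ 2) * (c ^ 2 * D + b / 2 * H) = b / 4 * D + 2 * k * H := by
    rw [hk]; field_simp; ring
  rw [e3]
  have eb : c ^ 2 / (4 * b) = (c ^ 2 / (2 * b)) / 2 := by field_simp; norm_num
  rw [eb] at b1 b2
  set q : ℝ := c ^ 2 / (2 * b) with hq
  have hq0 : 0 < q := by positivity
  have nGc : 0 ≤ c ^ 2 * G := by positivity
  have nLq : 0 ≤ q * L := by positivity
  have nGb : 0 ≤ g * (b / 2) * G := by positivity
  have nLb : 0 ≤ g * (b / 2) * L := by positivity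
  have nkH : 0 ≤ k * H := by positivity
  constructor
  · have m1 : min (1/4) k * ((1/2) * W + c ^ 2 / 2 * G + q * L)
        ≤ 1/4 * ((1/2) * W + c ^ 2 / 2 * G + q * L) :=
      mul_le_mul_of_nonneg_right (min_le_left _ _) (by positivity)
    have m2 : min (1/4) k * H ≤ k * H := mul_le_mul_of_nonneg_right (min_le_right _ _) nH
    linarith
  · have t1 : g * b / c ^ 2 * (c ^ 2 / 2 * G) = g * (b / 2) * G := by field_simp
    have t2 : g * b ^ 2 / c ^ 2 * (q * L) = g * (b / 2) * L := by rw [hq]; field_simp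
    have x1 : 0 ≤ g * b / c ^ 2 * ((1/2) * W + q * L + H) := by positivity
    have x2 : 0 ≤ g * b ^ 2 / c ^ 2 * ((1/2) * W + c ^ 2 / 2 * G + H) := by positivity
    have x3 : 0 ≤ 3 * k * ((1/2) * W + c ^ 2 / 2 * G + q * L) := by positivity
    linarith
end
end
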